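/- Let p_1 be a prime, let δ ∈ {0,1}, and let m, a, b be positive integers with m > 2. Let q_1,...,q_t be t distinct primes each dividing (m−1)·p_1^{2a+δ} + 1. If p_1 is self-conjugate modulo q_1···q_t and q_1···q_t > 2^{t−1}·((m−1)·p_1^{2a−b} + p_1^{−b}) (as real numbers), then there does not exist an ((m−1)·p_1^{2a+δ}+1, m, p_1^{a+b+δ}, p_1^{2b+δ})-SEDF in any finite abelian group. -/

import Mathlib

/-- A `(v,m,k,λ)`-strong external difference family in a finite abelian group `G`. -/
def IsSEDF {G : Type*} [CommGroup G] [Fintype G] [DecidableEq G]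
    {m : ℕ} (D : Fin m → Finset G) (k lam : ℕ) : Prop :=
  0 < m ∧ 0 < k ∧ 0 < lam ∧
  (∀ i, (D i).card = k) ∧
  (∀ i j, i ≠ j → Disjoint (D i) (D j)) ∧
  ∀ j : Fin m, ∀ g : G,
    (∑ l ∈ Finset.univ.filter (fun l => l ≠ j),
      (((D l) ×ˢ (D j)).filter (fun x => x.1 * x.2⁻¹ = g)).card)
    = if g = 1 then 0 else lam

/-- A prime `p` is self-conjugate modulo `w`: writing `w = p^s · u'` with `gcd(u',p) = 1`,
there exists `r` with `p^r ≡ -1 (mod u')`. -/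
def SelfConjPrime (p w : ℕ) : Prop :=
  ∃ r : ℕ, (p : ZMod (w / p ^ w.factorization p)) ^ r = -1

open Polynomial ComplexConjugate

theorem X_pow_sub_one_dvd_cyclotomic_mul_prod {w : ℕ} (hw : w ≠ 0) :
    (X ^ w - 1 : ℤ[X]) ∣ cyclotomic w ℤ * ∏ r ∈ w.primeFactors, (1 - X ^ (w / r)) := by
  have hmonic : (X ^ w - 1 : ℤ[X]).Monic := by
    simpa using monic_X_pow_sub_C (1 : ℤ) hw
  rw [← map_dvd_map (Int.castRingHom ℂ) Int.cast_injective hmonic]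
  have hζ := Complex.isPrimitiveRoot_exp w hw
  simp only [Polynomial.map_sub, Polynomial.map_pow, map_X, Polynomial.map_one]
  rw [X_pow_sub_one_eq_prod (Nat.pos_of_ne_zero hw) hζ]
  refine Finset.prod_dvd_of_coprime
    ((pairwise_coprime_X_sub_C Function.injective_id).set_pairwise _) fun μ hμ => ?_
  rw [mem_nthRootsFinset (Nat.pos_of_ne_zero hw)] at hμ
  rw [dvd_iff_isRoot, IsRoot, eval_map, eval₂_mul, mul_eq_zero]
  have hdvd := orderOf_dvd_of_pow_eq_one hμ
  by_cases h : orderOf μ = w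
  · left
    rw [← eval_map, map_cyclotomic]
    exact (h ▸ IsPrimitiveRoot.orderOf μ).isRoot_cyclotomic (Nat.pos_of_ne_zero hw)
  · right
    obtain ⟨c, hc⟩ := hdvd
    have hc1 : c ≠ 1 := by rintro rfl; simp at hc; exact h hc.symm
    obtain ⟨r, hr, k, rfl⟩ := Nat.exists_prime_and_dvd hc1
    rw [eval₂_finsetProd]
    refine Finset.prod_eq_zero (i := r) ?_ ?_
    · exact Nat.mem_primeFactors.2 ⟨hr, ⟨orderOf μ * k, by rw [hc]; ring⟩, hw⟩
    · have : w / r = orderOf μ * k :=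
        Nat.div_eq_of_eq_mul_left hr.pos (by rw [hc]; ring)
      rw [this, eval₂_sub, eval₂_one, eval₂_X_pow, pow_mul, pow_orderOf_eq_one, one_pow, sub_self]

theorem MonoidAlgebra.abs_coeff_mul_prod_one_sub_single_le {ι G : Type*} [CommGroup G]
    {B : MonoidAlgebra ℤ G} {C : ℤ} (hB : ∀ u, 0 ≤ B.coeff u ∧ B.coeff u ≤ C)
    {s : Finset ι} (hs : s.Nonempty) (g : ι → G) (u : G) :
    |(B * ∏ i ∈ s, (1 - single (g i) 1)).coeff u| ≤ 2 ^ (s.card - 1) * C := by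
  have step (A : MonoidAlgebra ℤ G) (h v : G) :
      (A * (1 - single h 1)).coeff v = A.coeff v - A.coeff (v * h⁻¹) := by
    rw [mul_sub, mul_one, MonoidAlgebra.coeff_sub, Finsupp.sub_apply,
      MonoidAlgebra.coeff_mul_single_apply, mul_one]
  induction hs using Finset.Nonempty.cons_induction generalizing u with
  | singleton a =>
    rw [Finset.prod_singleton, step, abs_le]
    have h1 := hB u
    have h2 := hB (u * (g a)⁻¹)
    simp
    constructor <;> linarith
  | cons a s ha hs ih =>
    rw [Finset.prod_cons, mul_comm (1 - _), ← mul_assoc, step]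
    refine (abs_sub _ _).trans ((add_le_add (ih u) (ih _)).trans (le_of_eq ?_))
    obtain ⟨n, hn⟩ := Nat.exists_eq_succ_of_ne_zero hs.card_ne_zero
    rw [Finset.card_cons, hn, Nat.succ_sub_one, Nat.add_sub_cancel, pow_succ]
    ring

theorem aeval_eq_zero_of_coeff_bound {w : ℕ} (hw : 1 < w) {ζ : ℂˣ}
    (hζ : IsPrimitiveRoot (ζ : ℂ) w) (F H : ℤ[X]) (C P : ℤ)
    (hF : ∀ u, 0 ≤ (aeval (MonoidAlgebra.single ζ (1 : ℤ)) F).coeff u ∧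
      (aeval (MonoidAlgebra.single ζ (1 : ℤ)) F).coeff u ≤ C)
    (hP : 2 ^ (w.primeFactors.card - 1) * C < P)
    (hdvd : aeval (ζ : ℂ) F = P * aeval (ζ : ℂ) H) : aeval (ζ : ℂ) F = 0 := by
  set σ : MonoidAlgebra ℤ ℂˣ := MonoidAlgebra.single ζ 1 with hσ
  have hw0 : w ≠ 0 := by omega
  have hσpow (n : ℕ) : σ ^ n = MonoidAlgebra.single (ζ ^ n) 1 := by
    simp [hσ, MonoidAlgebra.single_pow]
  have hcyc : cyclotomic w ℤ ∣ F - Polynomial.C P * H := by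
    rw [cyclotomic_eq_minpoly hζ (by omega)]
    refine minpoly.isIntegrallyClosed_dvd (hζ.isIntegral (by omega)) ?_
    simp [hdvd]
  obtain ⟨K, hK⟩ := (X_pow_sub_one_dvd_cyclotomic_mul_prod hw0).trans
    (mul_dvd_mul_right hcyc (∏ r ∈ w.primeFactors, (1 - X ^ (w / r))))
  have hK' := congrArg (aeval σ) hK
  have hζw : ζ ^ w = 1 := by ext; simpa using hζ.pow_eq_one
  have hprod : aeval σ (∏ r ∈ w.primeFactors, (1 - X ^ (w / r)) : ℤ[X]) =
      ∏ r ∈ w.primeFactors, (1 - MonoidAlgebra.single (ζ ^ (w / r)) 1) := by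
    simp [map_prod, hσpow]
  rw [map_mul, map_mul, map_sub, map_sub, map_mul, map_pow, aeval_X, aeval_C, map_one, hprod,
    hσpow, hζw, ← MonoidAlgebra.one_def, sub_self, zero_mul, sub_mul, sub_eq_zero, mul_assoc,
    ← Algebra.smul_def] at hK'
  have hne : w.primeFactors.Nonempty := Nat.nonempty_primeFactors.2 hw
  have hzero : aeval σ F * ∏ r ∈ w.primeFactors, (1 - MonoidAlgebra.single (ζ ^ (w / r)) 1) = 0 := by
    ext u
    have hb := MonoidAlgebra.abs_coeff_mul_prod_one_sub_single_le hF hne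
      (fun r => ζ ^ (w / r)) u
    refine Int.eq_zero_of_abs_lt_dvd (m := P) ?_ (hb.trans_lt hP)
    rw [hK', MonoidAlgebra.coeff_smul, Finsupp.smul_apply, smul_eq_mul]
    exact dvd_mul_right _ _
  have hev := congrArg (MonoidAlgebra.lift ℤ ℂ ℂˣ (Units.coeHom ℂ)) hzero
  have hlift : MonoidAlgebra.lift ℤ ℂ ℂˣ (Units.coeHom ℂ) (aeval σ F) = aeval (ζ : ℂ) F := by
    rw [← aeval_algHom_apply]
    simp [hσ]
  rw [map_mul, hlift, map_zero, mul_eq_zero] at hev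
  refine hev.resolve_right ?_
  rw [map_prod, ← ne_eq, Finset.prod_ne_zero_iff]
  intro r hr
  have hr' := Nat.prime_of_mem_primeFactors hr
  have := hζ.pow_ne_one_of_pos_of_lt (l := w / r)
    (Nat.div_pos (Nat.le_of_mem_primeFactors hr) hr'.pos).ne'
    (Nat.div_lt_self (by omega) hr'.one_lt)
  rw [map_sub, map_one, MonoidAlgebra.lift_single, one_smul, sub_ne_zero]
  simpa [eq_comm] using this

theorem exists_pow_prime_pow_eq_expand_add {p : ℕ} (hp : p.Prime) (F : ℤ[X]) (r : ℕ) :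
    ∃ H : ℤ[X], F ^ p ^ r = expand ℤ (p ^ r) F + C (p : ℤ) * H := by
  have := Fact.mk hp
  have key (f : (ZMod p)[X]) : expand (ZMod p) (p ^ r) f = f ^ p ^ r := by
    induction r with
    | zero => simp
    | succ r ih => rw [pow_succ', expand_mul, ih, map_pow, ZMod.expand_card, ← pow_mul]
  have hdvd : C (p : ℤ) ∣ F ^ p ^ r - expand ℤ (p ^ r) F := by
    rw [C_dvd_iff_dvd_coeff]
    intro i
    rw [← CharP.intCast_eq_zero_iff (ZMod p) p, ← eq_intCast (Int.castRingHom (ZMod p)),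
      ← coeff_map, Polynomial.map_sub, Polynomial.map_pow, map_expand, key, sub_self, coeff_zero]
  obtain ⟨H, hH⟩ := hdvd
  exact ⟨H, by rw [← hH]; ring⟩

theorem conj_aeval_int (z : ℂ) (F : ℤ[X]) : conj (aeval z F) = aeval (conj z) F :=
  (aeval_algHom_apply (starRingEnd ℂ).toIntAlgHom z F).symm

theorem exists_aeval_eq_prime_mul {p : ℕ} (hp : p.Prime) {r : ℕ} (hr : r ≠ 0) {ζ : ℂ}
    (hζ : ζ ^ p ^ r = conj ζ) (F M : ℤ[X])
    (h : aeval ζ F * conj (aeval ζ F) = p * aeval ζ M) :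
    ∃ H : ℤ[X], aeval ζ F = p * aeval ζ H := by
  obtain ⟨A, hA⟩ := exists_pow_prime_pow_eq_expand_add hp F r
  obtain ⟨B, hB⟩ := exists_pow_prime_pow_eq_expand_add hp F (r + r)
  have hA' := congrArg (aeval ζ) hA
  have hB' := congrArg (aeval ζ) hB
  have hζ2 : ζ ^ p ^ (r + r) = ζ := by
    rw [pow_add, pow_mul, hζ, ← map_pow, hζ, Complex.conj_conj]
  simp only [map_pow, map_add, map_mul, expand_aeval, hζ, hζ2, ← conj_aeval_int,
    map_natCast] at hA' hB'
  obtain ⟨e, he⟩ : ∃ e, p ^ (r + r) = p ^ r + 1 + e := by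
    refine Nat.exists_eq_add_of_le ?_
    have : 2 ≤ p ^ r := hp.two_le.trans (Nat.le_self_pow hr p)
    rw [pow_add]
    nlinarith
  rw [he, pow_add, pow_succ, hA'] at hB'
  refine ⟨(M + A * F) * F ^ e - B, ?_⟩
  simp only [map_sub, map_mul, map_add, map_pow]
  linear_combination (aeval ζ F) ^ e * h - hB'

theorem exists_aeval_eq_prime_pow_mul {p : ℕ} (hp : p.Prime) {r : ℕ} (hr : r ≠ 0) {ζ : ℂ}
    (hζ : ζ ^ p ^ r = conj ζ) {δ : ℕ} (hδ : δ = 0 ∨ δ = 1) (b : ℕ) (F M : ℤ[X])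
    (h : aeval ζ F * conj (aeval ζ F) = p ^ (2 * b + δ) * aeval ζ M) :
    ∃ H : ℤ[X], aeval ζ F = p ^ (b + δ) * aeval ζ H := by
  induction b generalizing F with
  | zero =>
    rcases hδ with rfl | rfl
    · exact ⟨F, by simp⟩
    · simpa using exists_aeval_eq_prime_mul hp hr hζ F M (by simpa using h)
  | succ b ih =>
    obtain ⟨H, hH⟩ := exists_aeval_eq_prime_mul hp hr hζ F (C ((p : ℤ) ^ (2 * b + δ + 1)) * M) (by
      rw [h]; simp; ring)
    have hp0 : (p : ℂ) ≠ 0 := Nat.cast_ne_zero.2 hp.ne_zero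
    obtain ⟨K, hK⟩ := ih H (by
      rw [hH, map_mul, Complex.conj_natCast] at h
      refine mul_left_cancel₀ (pow_ne_zero 2 hp0) ?_
      linear_combination h)
    exact ⟨K, by rw [hH, hK]; ring⟩

theorem pow_prime_pow_eq_conj {w p r : ℕ} (hw : w ≠ 0) {ζ : ℂ} (hζ : ζ ^ w = 1)
    (h : (p : ZMod w) ^ r = -1) : ζ ^ p ^ r = conj ζ := by
  have hdvd : w ∣ p ^ r + 1 := by
    rw [← ZMod.natCast_eq_zero_iff]
    push_cast
    rw [h]
    ring
  rw [← Complex.inv_eq_conj (Complex.norm_eq_one_of_pow_eq_one hζ hw)]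
  refine eq_inv_of_mul_eq_one_left ?_
  obtain ⟨c, hc⟩ := hdvd
  rw [← pow_succ, hc, pow_mul, hζ, one_pow]

theorem exists_rat_of_sq_sub_self_eq {m : ℕ} (hm : 2 < m) (r : Fin m → ℝ) {c : ℝ} (hc : 0 < c)
    (hr : ∀ j, r j ^ 2 - r j = c) (hsum : ∑ j, r j = 1) :
    ∃ i j, ∃ s : ℚ, 1 < s ∧ r i = s ∧ r j = 1 - s := by
  have hm' : (2 : ℝ) < m := by exact_mod_cast hm
  obtain ⟨i, -, hi⟩ : ∃ i ∈ Finset.univ, 0 < r i :=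
    Finset.exists_lt_of_sum_lt (f := fun _ => (0 : ℝ)) (by simp [hsum])
  have hi1 : 1 < r i := by nlinarith [hr i]
  have hdich (j) : r j = r i ∨ r j = 1 - r i := by
    have : (r j - r i) * (r j - (1 - r i)) = 0 := by linear_combination hr j - hr i
    rcases mul_eq_zero.1 this with h | h
    · exact .inl (by linarith)
    · exact .inr (by linarith)
  obtain ⟨j, hj⟩ : ∃ j, r j = 1 - r i := by
    by_contra! hne
    have : ∑ j, r j = m * r i := by
      simp [Finset.sum_congr rfl fun j _ => (hdich j).resolve_right (hne j)]
    nlinarith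
  set n : ℕ := (Finset.univ.filter fun j => r j = r i).card with hn
  have hsum' : ∑ j, r j = n * (2 * r i - 1) + m * (1 - r i) := by
    have hite (j) : r j = (if r j = r i then 2 * r i - 1 else 0) + (1 - r i) := by
      split_ifs with h
      · linarith
      · linarith [(hdich j).resolve_left h]
    rw [Finset.sum_congr rfl fun j _ => hite j, Finset.sum_add_distrib, ← Finset.sum_filter]
    simp [hn]
    ring
  rw [hsum] at hsum'
  have hne : (2 * n - m : ℝ) ≠ 0 := by
    intro h
    have : (n : ℝ) = m / 2 := by linarith
    rw [this] at hsum'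
    linarith
  have hs : r i = ((1 - m + n) / (2 * n - m) : ℚ) := by
    push_cast
    rw [eq_div_iff hne]
    linarith
  refine ⟨i, j, _, ?_, hs, hs ▸ hj⟩
  rw [hs] at hi1
  exact_mod_cast hi1

theorem exists_rat_normSq {m : ℕ} (hm : 2 < m) (x : Fin m → ℂ) {lam : ℕ} (hlam : 0 < lam)
    (h : ∀ j, (∑ l ∈ Finset.univ.filter (fun l => l ≠ j), x l) * conj (x j) = -(lam : ℂ)) :
    ∃ i j, ∃ N N' : ℚ, Complex.normSq (x i) = N ∧ Complex.normSq (x j) = N' ∧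
      N * N' = lam ^ 2 ∧ (lam : ℚ) ≤ N := by
  have hlamR : (0 : ℝ) < lam := by exact_mod_cast hlam
  set S := ∑ l, x l with hS
  have hSj (j) : S * conj (x j) = (Complex.normSq (x j) - lam : ℝ) := by
    have h1 := h j
    rw [Finset.filter_ne'] at h1
    push_cast
    rw [← Complex.mul_conj, hS, ← Finset.sum_erase_add _ _ (Finset.mem_univ j), add_mul, h1]
    ring
  by_cases h0 : S = 0
  · have hN (j) : Complex.normSq (x j) = (lam : ℚ) := by
      have := hSj j
      rw [h0, zero_mul, eq_comm, Complex.ofReal_eq_zero] at this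
      push_cast
      linarith
    exact ⟨⟨0, by omega⟩, ⟨0, by omega⟩, lam, lam, hN _, hN _, by ring, le_rfl⟩
  have hS0 : 0 < Complex.normSq S := Complex.normSq_pos.2 h0
  set r : Fin m → ℝ := fun j => (Complex.normSq (x j) - lam) / Complex.normSq S with hrdef
  have hxr (j) : x j = r j * S := by
    have h1 := congrArg conj (hSj j)
    rw [map_mul, Complex.conj_conj, Complex.conj_ofReal] at h1
    have hSc : (Complex.normSq S : ℂ) ≠ 0 := by exact_mod_cast hS0.ne'
    rw [hrdef]
    push_cast
    rw [div_mul_eq_mul_div, eq_div_iff hSc, ← Complex.mul_conj]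
    push_cast at h1
    linear_combination S * h1
  have hN (j) : Complex.normSq (x j) = r j ^ 2 * Complex.normSq S := by
    conv_lhs => rw [hxr j, Complex.normSq_mul, Complex.normSq_ofReal]
    ring
  have hrS (j) : r j * Complex.normSq S = Complex.normSq (x j) - lam :=
    div_mul_cancel₀ _ hS0.ne'
  obtain ⟨i, j, s, hs1, hi, hj⟩ := exists_rat_of_sq_sub_self_eq hm r
    (div_pos hlamR hS0)
    (fun j => by rw [eq_div_iff hS0.ne']; linear_combination -hN j - hrS j)
    (by
      have : (∑ j, (r j : ℂ)) * S = 1 * S := by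
        rw [Finset.sum_mul, one_mul, hS]
        exact Finset.sum_congr rfl fun j _ => (hxr j).symm
      exact_mod_cast mul_right_cancel₀ h0 this)
  have hs1R : (1 : ℝ) < s := by exact_mod_cast hs1
  have hSs : Complex.normSq S * (s * (s - 1)) = lam := by
    have h1 := hN i
    have h2 := hrS i
    rw [hi] at h1 h2
    linear_combination -h1 - h2
  have hs0 : (s : ℝ) ≠ 0 := by positivity
  have hs0' : (s - 1 : ℝ) ≠ 0 := by linarith
  have hsq : s - 1 ≠ 0 := by linarith
  have hsq0 : s ≠ 0 := by linarith
  refine ⟨i, j, lam * s / (s - 1), lam * (s - 1) / s, ?_, ?_, ?_, ?_⟩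
  · rw [hN, hi]; push_cast; rw [eq_div_iff hs0', ← hSs]; ring
  · rw [hN, hj]; push_cast; rw [eq_div_iff hs0, ← hSs]; ring
  · field_simp
  · rw [le_div_iff₀ (by linarith)]
    have : (0 : ℚ) < lam := by exact_mod_cast hlam
    nlinarith

theorem exists_monoidHom_orderOf_eq {G : Type*} [CommGroup G] [Fintype G] {w : ℕ}
    (hw : Squarefree w) (hdvd : w ∣ Fintype.card G) : ∃ χ : G →* ℂˣ, orderOf χ = w := by
  have ⟨e⟩ := CommGroup.monoidHom_mulEquiv_of_hasEnoughRootsOfUnity G ℂ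
  have : Finite (G →* ℂˣ) := .of_equiv G e.symm.toEquiv
  have hexp : w ∣ Monoid.exponent (G →* ℂˣ) := by
    rw [← Nat.prod_primeFactors_of_squarefree hw]
    refine Finset.prod_primes_dvd _ (fun r hr => (Nat.prime_of_mem_primeFactors hr).prime)
      fun r hr => ?_
    have := Fact.mk (Nat.prime_of_mem_primeFactors hr)
    have hr : r ∣ Nat.card (G →* ℂˣ) := by
      rw [Nat.card_congr e.toEquiv, Nat.card_eq_fintype_card]
      exact (Nat.dvd_of_mem_primeFactors hr).trans hdvd
    obtain ⟨x, hx⟩ := exists_prime_orderOf_dvd_card' r hr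
    exact hx ▸ Monoid.order_dvd_exponent x
  obtain ⟨x, hx⟩ := Monoid.exists_orderOf_eq_exponent
    (Monoid.ExponentExists.of_finite (G := G →* ℂˣ))
  exact ⟨_, orderOf_pow_orderOf_div (orderOf_pos x).ne' (hx ▸ hexp)⟩

theorem exists_isPrimitiveRoot_of_orderOf_eq {G : Type*} [CommGroup G] [Finite G] {w : ℕ}
    {χ : G →* ℂˣ} (hχ : orderOf χ = w) :
    Nat.card χ.range = w ∧ ∃ ζ : ℂˣ, IsPrimitiveRoot ζ w ∧ ∀ g, ∃ n : ℕ, χ g = ζ ^ n := by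
  have : Finite χ.range := Set.finite_range χ
  obtain ⟨y, hy⟩ := IsCyclic.exists_monoid_generator (α := χ.range)
  have hcard : orderOf y = Nat.card χ.range :=
    orderOf_eq_card_of_forall_mem_powers hy
  have hyw : orderOf y = w := by
    refine Nat.dvd_antisymm (orderOf_dvd_of_pow_eq_one ?_) ?_
    · obtain ⟨g, hg⟩ := y.2
      refine Subtype.ext (?_ : (y : ℂˣ) ^ w = 1)
      rw [← hg, ← MonoidHom.pow_apply, ← hχ, pow_orderOf_eq_one, MonoidHom.one_apply]
    · rw [← hχ, hcard]
      refine orderOf_dvd_of_pow_eq_one (MonoidHom.ext fun g => ?_)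
      have := pow_card_eq_one' (x := (⟨χ g, g, rfl⟩ : χ.range))
      exact congrArg Subtype.val this
  refine ⟨hcard ▸ hyw, y, ?_, fun g => ?_⟩
  · rw [← hyw, ← Subgroup.orderOf_coe]
    exact IsPrimitiveRoot.orderOf _
  · obtain ⟨n, hn⟩ := Submonoid.mem_powers_iff _ _ |>.1 (hy ⟨χ g, g, rfl⟩)
    exact ⟨n, (congrArg Subtype.val hn).symm⟩

theorem MonoidHom.card_filter_apply_eq_mul_card_range_le {G H : Type*} [Group G] [Fintype G] [Group H]
    [DecidableEq H] (χ : G →* H) (D : Finset G) (u : H) :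
    (D.filter fun g => χ g = u).card * Nat.card χ.range ≤ Fintype.card G := by
  have hker : (Finset.univ.filter fun g => χ g = 1).card = Nat.card χ.ker := by
    simp_rw [← χ.mem_ker]
    rw [Nat.card_eq_fintype_card, Fintype.card_subtype]
  rw [← Nat.card_eq_fintype_card, ← χ.ker.card_mul_index, Subgroup.index_ker, ← hker]
  refine Nat.mul_le_mul_right _ ?_
  by_cases hu : u ∈ Set.range χ
  · rw [MonoidHom.card_fiber_eq_of_mem_range χ ⟨1, map_one χ⟩ hu]
    exact Finset.card_le_card (Finset.filter_subset_filter _ (Finset.subset_univ D))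
  · rw [Finset.filter_false_of_mem fun g _ h => hu ⟨g, h⟩]
    simp

theorem conj_monoidHom_units {G : Type*} [Group G] [Finite G] (χ : G →* ℂˣ) (g : G) :
    conj (χ g : ℂ) = χ g⁻¹ := by
  have h : (χ g : ℂ) ^ Nat.card G = 1 := by
    rw [← Units.val_pow_eq_pow_val, ← map_pow, pow_card_eq_one', map_one, Units.val_one]
  rw [← Complex.inv_eq_conj (Complex.norm_eq_one_of_pow_eq_one h Nat.card_pos.ne'), map_inv,
    Units.val_inv_eq_inv_val]

theorem IsSEDF.sum_monoidHom_mul_conj {G : Type*} [CommGroup G] [Fintype G] [DecidableEq G]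
    {m : ℕ} {D : Fin m → Finset G} {k lam : ℕ} (hD : IsSEDF D k lam) {χ : G →* ℂˣ} (hχ : χ ≠ 1)
    (j : Fin m) :
    (∑ l ∈ Finset.univ.filter (fun l => l ≠ j), ∑ g ∈ D l, (χ g : ℂ)) *
      conj (∑ g ∈ D j, (χ g : ℂ)) = -(lam : ℂ) := by
  have hcount := hD.2.2.2.2.2 j
  have hterm (l : Fin m) : (∑ g ∈ D l, (χ g : ℂ)) * conj (∑ g ∈ D j, (χ g : ℂ)) =
      ∑ g, (((D l ×ˢ D j).filter fun x => x.1 * x.2⁻¹ = g).card : ℂ) * χ g := by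
    rw [map_sum, Finset.sum_mul_sum, ← Finset.sum_product',
      ← Finset.sum_fiberwise (D l ×ˢ D j) fun x => x.1 * x.2⁻¹]
    refine Finset.sum_congr rfl fun g _ => ?_
    rw [← nsmul_eq_mul]
    refine Finset.sum_eq_card_nsmul fun x hx => ?_
    rw [conj_monoidHom_units, ← Units.val_mul, ← map_mul, (Finset.mem_filter.1 hx).2]
  have hsum0 : ∑ g, (χ g : ℂ) = 0 :=
    sum_hom_units_eq_zero ((Units.coeHom ℂ).comp χ) fun h => hχ <| by
      ext g
      simpa using DFunLike.congr_fun h g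
  rw [Finset.sum_mul, Finset.sum_congr rfl fun l _ => hterm l, Finset.sum_comm]
  have (g : G) : ∑ l ∈ Finset.univ.filter (fun l => l ≠ j),
      (((D l ×ˢ D j).filter fun x => x.1 * x.2⁻¹ = g).card : ℂ) * χ g =
      lam * χ g - if g = 1 then (lam : ℂ) else 0 := by
    rw [← Finset.sum_mul, ← Nat.cast_sum, hcount g]
    split_ifs with h <;> simp [h]
  rw [Finset.sum_congr rfl fun g _ => this g, Finset.sum_sub_distrib, ← Finset.mul_sum, hsum0]
  simp

theorem isIntegral_sum_monoidHom_units {G : Type*} [Group G] [Finite G] (χ : G →* ℂˣ)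
    (D : Finset G) : IsIntegral ℤ (∑ g ∈ D, (χ g : ℂ)) := by
  refine IsIntegral.sum _ fun g _ => IsIntegral.of_pow (n := Nat.card G) Nat.card_pos ?_
  rw [← Units.val_pow_eq_pow_val, ← map_pow, pow_card_eq_one', map_one, Units.val_one]
  exact isIntegral_one

theorem exists_nat_eq_of_normSq_eq_rat {x : ℂ} (hx : IsIntegral ℤ x) {N : ℚ}
    (hN : Complex.normSq x = N) : ∃ n : ℕ, N = n := by
  have hint : IsIntegral ℤ (algebraMap ℚ ℂ N) := by
    have : algebraMap ℚ ℂ N = x * conj x := by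
      rw [Complex.mul_conj, hN]
      simp
    rw [this]
    exact hx.mul (hx.map (starRingEnd ℂ).toIntAlgHom)
  rw [isIntegral_algebraMap_iff (algebraMap ℚ ℂ).injective, IsIntegrallyClosed.isIntegral_iff] at hint
  obtain ⟨z, rfl⟩ := hint
  have hz : 0 ≤ z := by
    have h := Complex.normSq_nonneg x
    rw [hN, eq_intCast] at h
    exact_mod_cast h
  lift z to ℕ using hz
  exact ⟨z, by simp⟩

theorem IsSEDF.exists_normSq_eq_mul {G : Type*} [CommGroup G] [Fintype G] [DecidableEq G]
    {m : ℕ} {D : Fin m → Finset G} {k p c : ℕ} (hm : 2 < m) (hp : p.Prime)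
    (hD : IsSEDF D k (p ^ c)) {χ : G →* ℂˣ} (hχ : χ ≠ 1) :
    ∃ j, ∃ M : ℕ, M ≠ 0 ∧ Complex.normSq (∑ g ∈ D j, (χ g : ℂ)) = p ^ c * M := by
  obtain ⟨i, j, N, N', hN, hN', hmul, hle⟩ := exists_rat_normSq hm _ (pow_pos hp.pos c)
    (hD.sum_monoidHom_mul_conj hχ)
  obtain ⟨n, rfl⟩ := exists_nat_eq_of_normSq_eq_rat (isIntegral_sum_monoidHom_units χ _) hN
  obtain ⟨n', rfl⟩ := exists_nat_eq_of_normSq_eq_rat (isIntegral_sum_monoidHom_units χ _) hN'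
  norm_cast at hmul hle
  rw [← pow_mul] at hmul
  obtain ⟨e, -, rfl⟩ := (Nat.dvd_prime_pow hp).1 (Dvd.intro _ hmul)
  obtain ⟨d, rfl⟩ := Nat.exists_eq_add_of_le ((Nat.pow_le_pow_iff_right hp.one_lt).1 hle)
  refine ⟨i, p ^ d, (pow_pos hp.pos d).ne', ?_⟩
  rw [hN]
  push_cast
  ring

/-- If `p` is self-conjugate modulo `w` and a character of order `w` takes on a subset of `G` a sum
whose squared modulus is a nonzero multiple of `p ^ (2 * b + δ)`, then `p ^ (b + δ)` is bounded in
terms of `w` and the order of `G`. -/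
theorem pow_mul_le_of_normSq_eq {G : Type*} [CommGroup G] [Fintype G] {w p r b δ M : ℕ}
    (hw : 1 < w) (hp : p.Prime) (hr : r ≠ 0) (hself : (p : ZMod w) ^ r = -1)
    (hδ : δ = 0 ∨ δ = 1) {χ : G →* ℂˣ} (hχ : orderOf χ = w) (D : Finset G) (hM : M ≠ 0)
    (hD : Complex.normSq (∑ g ∈ D, (χ g : ℂ)) = p ^ (2 * b + δ) * M) :
    p ^ (b + δ) * w ≤ 2 ^ (w.primeFactors.card - 1) * Fintype.card G := by
  classical
  obtain ⟨hcard, ζ, hζ, hpow⟩ := exists_isPrimitiveRoot_of_orderOf_eq hχ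
  choose n hn using hpow
  have hζ' : IsPrimitiveRoot (ζ : ℂ) w := IsPrimitiveRoot.coe_units_iff.2 hζ
  set F : ℤ[X] := ∑ g ∈ D, X ^ n g with hF
  have hFζ : aeval (ζ : ℂ) F = ∑ g ∈ D, (χ g : ℂ) := by simp [hF, hn]
  have hFσ (u : ℂˣ) : (aeval (MonoidAlgebra.single ζ (1 : ℤ)) F).coeff u =
      ((D.filter fun g => χ g = u).card : ℤ) := by
    simp [hF, MonoidAlgebra.single_pow, ← hn, MonoidAlgebra.coeff_sum, Finsupp.single_apply]
  obtain ⟨H, hH⟩ := exists_aeval_eq_prime_pow_mul hp hr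
    (pow_prime_pow_eq_conj (by omega) hζ'.pow_eq_one hself) hδ b F M (by
      rw [hFζ, Complex.mul_conj, hD]
      simp)
  by_contra! hlt
  have hzero := aeval_eq_zero_of_coeff_bound hw hζ' F H ((Fintype.card G / w : ℕ) : ℤ)
    ((p ^ (b + δ) : ℕ) : ℤ)
    (fun u => by
      rw [hFσ]
      refine ⟨Int.natCast_nonneg _, ?_⟩
      rw [Int.ofNat_le, Nat.le_div_iff_mul_le (by omega), ← hcard]
      exact χ.card_filter_apply_eq_mul_card_range_le D u)
    (by
      have : 2 ^ (w.primeFactors.card - 1) * (Fintype.card G / w) < p ^ (b + δ) := by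
        refine Nat.lt_of_mul_lt_mul_right (a := w) (lt_of_le_of_lt ?_ hlt)
        rw [mul_assoc]
        exact Nat.mul_le_mul_left _ (Nat.div_mul_le_self _ _)
      exact_mod_cast this)
    (by rw [hH]; simp)
  rw [hFζ] at hzero
  rw [hzero, map_zero, eq_comm] at hD
  have : p ≠ 0 := hp.ne_zero
  simp_all

/-- Nonexistence of `((m-1)p₁^{2a+δ}+1, m, p₁^{a+b+δ}, p₁^{2b+δ})`-SEDFs when
`q_1, …, q_t` are distinct primes dividing `(m-1)p₁^{2a+δ}+1`, `p₁` is self-conjugate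
modulo `q_1⋯q_t`, and `q_1⋯q_t > 2^{t-1}·((m-1)p₁^{2a-b} + p₁^{-b})`. -/
theorem sedf_nonexistence_one_prime
    (p₁ : ℕ) (hp₁ : p₁.Prime) (δ : ℕ) (hδ : δ = 0 ∨ δ = 1)
    (m a b : ℕ) (hm : 2 < m) (ha : 0 < a) (hb : 0 < b)
    (t : ℕ) (q : Fin t → ℕ) (hq : ∀ i, (q i).Prime) (hqinj : Function.Injective q)
    (hqdvd : ∀ i, q i ∣ (m - 1) * p₁ ^ (2 * a + δ) + 1)
    (hsc : SelfConjPrime p₁ (∏ i, q i))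
    (hineq : (∏ i, (q i : ℝ)) >
      2 ^ (t - 1) * ((m - 1) * (p₁ : ℝ) ^ (2 * (a : ℤ) - (b : ℤ)) + (p₁ : ℝ) ^ (-(b : ℤ)))) :
    ∀ (G : Type) [CommGroup G] [Fintype G] [DecidableEq G] (D : Fin m → Finset G),
      Fintype.card G = (m - 1) * p₁ ^ (2 * a + δ) + 1 →
      ¬ IsSEDF D (p₁ ^ (a + b + δ)) (p₁ ^ (2 * b + δ)) := by
  intro G _ _ _ D hG hD
  set w := ∏ i, q i with hw
  have hwimg : w = ∏ r ∈ Finset.univ.image q, r := by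
    rw [Finset.prod_image hqinj.injOn]
  have hprime : ∀ r ∈ Finset.univ.image q, r.Prime := by simpa using hq
  have hpf : w.primeFactors = Finset.univ.image q := hwimg ▸ Nat.primeFactors_prod hprime
  have ht : w.primeFactors.card = t := by
    rw [hpf, Finset.card_image_of_injective _ hqinj, Finset.card_univ, Fintype.card_fin]
  have hwdvd : w ∣ Fintype.card G := by
    rw [hwimg, hG]
    exact Finset.prod_primes_dvd _ (fun r hr => (hprime r hr).prime) (by simpa using hqdvd)
  have hw0 : w ≠ 0 := Finset.prod_ne_zero_iff.2 fun i _ => (hq i).ne_zero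
  have hbound : 2 ^ (t - 1) * Fintype.card G < p₁ ^ (b + δ) * w := by
    have hp0 : (0 : ℝ) < p₁ := by exact_mod_cast hp₁.pos
    have hpd : (1 : ℝ) ≤ (p₁ : ℝ) ^ δ := one_le_pow₀ (by exact_mod_cast hp₁.one_le)
    have h1 := mul_lt_mul_of_pos_right hineq (pow_pos hp0 (b + δ))
    have h2 : (p₁ : ℝ) ^ (2 * (a : ℤ) - b) * p₁ ^ (b + δ) = p₁ ^ (2 * a + δ) := by
      rw [← zpow_natCast, ← zpow_natCast, ← zpow_add₀ hp0.ne']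
      congr 1
      push_cast
      ring
    have h3 : (p₁ : ℝ) ^ (-(b : ℤ)) * p₁ ^ (b + δ) = p₁ ^ δ := by
      rw [← zpow_natCast, ← zpow_natCast, ← zpow_add₀ hp0.ne']
      congr 1
      push_cast
      ring
    have h4 : (2 : ℝ) ^ (t - 1) * Fintype.card G < p₁ ^ (b + δ) * w := by
      rw [hG, hw]
      push_cast [Nat.cast_sub (by omega : 1 ≤ m)]
      calc (2 : ℝ) ^ (t - 1) * ((m - 1) * p₁ ^ (2 * a + δ) + 1)
          ≤ 2 ^ (t - 1) * ((m - 1) * p₁ ^ (2 * a + δ) + p₁ ^ δ) := by gcongr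
        _ < (∏ i, (q i : ℝ)) * p₁ ^ (b + δ) := by
            refine lt_of_eq_of_lt ?_ h1
            rw [← h2, ← h3]
            ring
        _ = _ := mul_comm _ _
    exact_mod_cast h4
  rcases Nat.lt_or_ge 1 w with hw1 | hw1
  · have hcop : Nat.Coprime p₁ w := by
      refine Nat.Coprime.coprime_dvd_right hwdvd ?_
      rw [hp₁.coprime_iff_not_dvd, hG, Nat.dvd_add_right
        ((dvd_pow_self p₁ (by omega)).mul_left _)]
      exact hp₁.one_lt.ne' ∘ Nat.dvd_one.1
    obtain ⟨r, hr⟩ := hsc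
    rw [Nat.factorization_eq_zero_of_not_dvd
      ((Nat.Prime.coprime_iff_not_dvd hp₁).1 hcop), pow_zero, Nat.div_one] at hr
    have hr' : (p₁ : ZMod w) ^ (r + w.totient) = -1 := by
      have h := congrArg Units.val (ZMod.pow_totient (ZMod.unitOfCoprime p₁ hcop))
      rw [Units.val_pow_eq_pow_val, ZMod.coe_unitOfCoprime, Units.val_one] at h
      rw [pow_add, hr, h, mul_one]
    have htot : r + w.totient ≠ 0 := by
      have := Nat.totient_pos.2 (Nat.pos_of_ne_zero hw0)
      omega
    have hsq : Squarefree w := by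
      rw [hwimg]
      refine Finset.squarefree_prod_of_pairwise_isCoprime (fun x hx y hy hxy => ?_)
        fun r hr => (hprime r hr).prime.squarefree
      exact Nat.coprime_iff_isRelPrime.1 ((Nat.coprime_primes (hprime x hx) (hprime y hy)).2 hxy)
    obtain ⟨χ, hχ⟩ := exists_monoidHom_orderOf_eq hsq hwdvd
    have hχ1 : χ ≠ 1 := by
      rintro rfl
      rw [orderOf_one] at hχ
      omega
    obtain ⟨j, M, hM, hj⟩ := hD.exists_normSq_eq_mul hm hp₁ hχ1
    have := pow_mul_le_of_normSq_eq hw1 hp₁ htot hr' hδ hχ (D j) hM hj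
    rw [ht] at this
    omega
  · have hw1' : w = 1 := by omega
    have hk : p₁ ^ (a + b + δ) ≤ Fintype.card G :=
      hD.2.2.2.1 ⟨0, by omega⟩ ▸ Finset.card_le_univ _
    have h1 : p₁ ^ (b + δ) ≤ p₁ ^ (a + b + δ) := Nat.pow_le_pow_right hp₁.pos (by omega)
    have h2 : 1 ≤ 2 ^ (t - 1) := Nat.one_le_two_pow
    rw [hw1', mul_one] at hbound
    nlinarith
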